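/- arXiv:2311.10337 — 5 statements merged into one kernel-verified Lean document; each statement's English description precedes it below -/
import Mathlib

section
/- Let G be a finite connected simple graph with edge weight function w and let M be a minimum spanning tree of G. For any vertices u and v and any walk P from u to v in G, every edge on the unique path from u to v in the tree M has weight at most the maximum edge weight appearing on P. -/
/-- The total weight of (the edges of) a graph. -/
noncomputable def graphWeight {V : Type*} (M : SimpleGraph V) (w : Sym2 V → ℝ) : ℝ :=
  ∑ᶠ e ∈ M.edgeSet, w e

/-- `M` is a minimum spanning tree of the weighted graph `(G, w)`. -/
def IsMST {V : Type*} (G : SimpleGraph V) (w : Sym2 V → ℝ) (M : SimpleGraph V) : Prop :=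
  M ≤ G ∧ M.IsTree ∧
    ∀ M' : SimpleGraph V, M' ≤ G → M'.IsTree → graphWeight M w ≤ graphWeight M' w

/-- **Minimax (bottleneck) property of MST paths.**  Let `M` be a minimum
spanning tree of the finite connected weighted graph `(G, w)`, let `u, v` be
vertices and let `P` be any walk from `u` to `v` in `G`.  Then every edge on
the (unique) path `Q` from `u` to `v` inside the tree `M` has weight at most
the maximum edge weight appearing on `P`, i.e. every edge of `Q` is dominated
in weight by some edge of `P`. -/
theorem mst_path_minimax {V : Type*} [Fintype V]
    (G : SimpleGraph V) (hG : G.Connected) (w : Sym2 V → ℝ)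
    (M : SimpleGraph V) (hM : IsMST G w M) (u v : V)
    (P : G.Walk u v) (Q : M.Walk u v) (hQ : Q.IsPath) :
    ∀ e ∈ Q.edges, ∃ e' ∈ P.edges, w e ≤ w e' := by
  classical
  intro e he
  obtain ⟨hle, hT, hmin⟩ := hM
  by_contra! hcon
  have heM : e ∈ M.edgeSet := Q.edges_subset_edgeSet he
  set D := M.deleteEdges {e} with hD
  have hDM : D ≤ M := SimpleGraph.deleteEdges_le _
  have huv : ¬ D.Reachable u v := by
    rintro ⟨p⟩
    have hp : (p.toPath.1.mapLe hDM).IsPath := p.toPath.2.mapLe hDM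
    have heq := hT.isAcyclic.path_unique ⟨_, hp⟩ ⟨Q, hQ⟩
    have heq' : p.toPath.1.mapLe hDM = Q := congrArg Subtype.val heq
    rw [← heq', SimpleGraph.Walk.edges_mapLe_eq_edges] at he
    have := p.toPath.1.edges_subset_edgeSet he
    simp [hD] at this
  obtain ⟨d, hdP, hda, hdb⟩ := P.exists_boundary_dart {c | D.Reachable u c}
    (SimpleGraph.Reachable.refl u) huv
  obtain ⟨⟨a, b⟩, hab⟩ := d
  simp only [Set.mem_setOf_eq] at hda hdb hab
  have hP : s(a, b) ∈ P.edges := List.mem_map.2 ⟨_, hdP, rfl⟩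
  have hlt := hcon _ hP
  have hnr : ¬ D.Reachable a b := fun h => hdb (hda.trans h)
  have hac : (D ⊔ SimpleGraph.edge a b).IsAcyclic :=
    SimpleGraph.IsAcyclic.sup_edge_of_not_reachable hnr (hT.isAcyclic.anti hDM)
  obtain ⟨x, y⟩ := e
  change s(x, y) ∈ M.edgeSet at heM
  have hor : ∀ c, D.Reachable x c ∨ D.Reachable y c := by
    intro c
    obtain ⟨p⟩ := hT.connected.preconnected c x
    have key : ∀ c z : V, M.Walk c z → (D.Reachable x z ∨ D.Reachable y z) →
        (D.Reachable x c ∨ D.Reachable y c) := by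
      intro c z p
      induction p with
      | nil => exact id
      | @cons c1 c2 c3 h p ih =>
        intro hz
        by_cases hc : s(c1, c2) = s(x, y)
        · rcases Sym2.eq_iff.1 hc with ⟨h1, h2⟩ | ⟨h1, h2⟩
          · left; rw [h1]
          · right; rw [h1]
        · have hadj : D.Adj c2 c1 := by
            apply SimpleGraph.Adj.symm
            rw [hD, SimpleGraph.deleteEdges_adj]
            exact ⟨h, hc⟩
          exact (ih hz).imp (fun h => h.trans hadj.reachable) (fun h => h.trans hadj.reachable)
    exact key c x p (Or.inl (SimpleGraph.Reachable.refl x))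
  set M' := D ⊔ SimpleGraph.edge a b with hM'
  have hDM' : D ≤ M' := le_sup_left
  have hab' : M'.Reachable a b := by
    apply SimpleGraph.Adj.reachable
    rw [hM', SimpleGraph.sup_adj, SimpleGraph.edge_adj]
    exact Or.inr ⟨Or.inl ⟨rfl, rfl⟩, hab.ne⟩
  have hxy : M'.Reachable x y := by
    rcases hor a with h1 | h1 <;> rcases hor b with h2 | h2
    · exact absurd (h1.symm.trans h2) hnr
    · exact ((h1.mono hDM').trans hab').trans (h2.mono hDM').symm
    · exact (((h1.mono hDM').trans hab').trans (h2.mono hDM').symm).symm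
    · exact absurd (h1.symm.trans h2) hnr
  have hx : ∀ c, M'.Reachable x c := fun c =>
    (hor c).elim (fun h => h.mono hDM') (fun h => hxy.trans (h.mono hDM'))
  have hconn : M'.Connected :=
    { preconnected := fun c c' => (hx c).symm.trans (hx c'), nonempty := ⟨x⟩ }
  have hM'G : M' ≤ G := sup_le (hDM.trans hle) (by
    rw [SimpleGraph.edge_le_iff]; exact Or.inr hab)
  have hw := hmin M' hM'G ⟨hconn, hac⟩
  have hDe : D.edgeSet = M.edgeSet \ {s(x, y)} := SimpleGraph.edgeSet_deleteEdges _
  have e1 : M.edgeSet = insert s(x, y) D.edgeSet := by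
    rw [hDe, Set.insert_diff_singleton, Set.insert_eq_of_mem heM]
  have e2 : M'.edgeSet = insert s(a, b) D.edgeSet := by
    rw [hM', SimpleGraph.edgeSet_sup, SimpleGraph.edgeSet_edge_of_ne hab.ne, Set.union_comm]; rfl
  have n1 : s(x, y) ∉ D.edgeSet := by rw [hDe]; simp
  have n2 : s(a, b) ∉ D.edgeSet := fun h => hnr (SimpleGraph.Adj.reachable h)
  unfold graphWeight at hw
  rw [e1, e2, finsum_mem_insert _ n1 (Set.toFinite _), finsum_mem_insert _ n2 (Set.toFinite _)] at hw
  have hlt' : w s(a, b) < w s(x, y) := hlt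
  linarith
end

section
/- Let P and Q be disjoint finite sets equipped with an injective time function t : P ⊔ Q → ℝ. Let B be the weighted bipartite graph on vertex set P ⊔ Q that has an edge between p ∈ P and q ∈ Q if and only if t(p) ≤ t(q), with weight t(q) − t(p). Define T to be the set of pairs (p, q) with p ∈ P, q ∈ Q, t(p) ≤ t(q), such that there exist no p' ∈ P and q' ∈ Q with t(p) < t(p') ≤ t(q') < t(q). Then T is a minimum-weight spanning forest of B: (a) the graph on P ⊔ Q with edge set T has exactly the same connected components as B; (b) the graph with edge set T contains no cycle; and (c) the total weight of T is at most the total weight of any set T' of edges of B for which the graph with edge set T' has the same connected components as B. -/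
/-- The edge relation of the weighted bipartite graph `B` on parts `P` and `Q`
with time function `t`: an edge from `p ∈ P` to `q ∈ Q` exists iff `t p ≤ t q`
(its weight being `t q - t p`). -/
def Bedge {α : Type*} (P Q : Set α) (t : α → ℝ) (x y : α) : Prop :=
  x ∈ P ∧ y ∈ Q ∧ t x ≤ t y

/-- The edge set produced by the node-local MST algorithm: pairs `(p, q)` with
`p ∈ P`, `q ∈ Q`, `t p ≤ t q`, such that there are no `p' ∈ P`, `q' ∈ Q` with
`t p < t p' ≤ t q' < t q`. -/
def TSet {α : Type*} (P Q : Set α) (t : α → ℝ) : Set (α × α) :=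
  { pq | pq.1 ∈ P ∧ pq.2 ∈ Q ∧ t pq.1 ≤ t pq.2 ∧
      ¬ ∃ p' ∈ P, ∃ q' ∈ Q, t pq.1 < t p' ∧ t p' ≤ t q' ∧ t q' < t pq.2 }

/-- The graph of a set of pairs. -/
abbrev GG {α : Type*} (T : Set (α × α)) : SimpleGraph α :=
  SimpleGraph.fromRel fun a b => (a, b) ∈ T

lemma reach_of_adj_reach {α : Type*} {G H : SimpleGraph α}
    (h : ∀ a b, G.Adj a b → H.Reachable a b) {x y : α} (hr : G.Reachable x y) :
    H.Reachable x y := by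
  obtain ⟨w⟩ := hr
  induction w with
  | nil => exact SimpleGraph.Reachable.refl _
  | cons hadj _ ih => exact (h _ _ hadj).trans ih

lemma GG_reach_of {α : Type*} {T : Set (α × α)} {H : SimpleGraph α}
    (h : ∀ a b, (a, b) ∈ T → H.Reachable a b) {x y : α} (hr : (GG T).Reachable x y) :
    H.Reachable x y := by
  refine reach_of_adj_reach (fun a b hab => ?_) hr
  rw [SimpleGraph.fromRel_adj] at hab
  rcases hab.2 with h1 | h1
  · exact h _ _ h1
  · exact (h _ _ h1).symm

lemma GG_reach_mem {α : Type*} {T : Set (α × α)} {a b : α} (h : (a, b) ∈ T) :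
    (GG T).Reachable a b := by
  by_cases hab : a = b
  · subst hab; exact SimpleGraph.Reachable.refl _
  · exact SimpleGraph.Adj.reachable ((SimpleGraph.fromRel_adj _ _ _).2 ⟨hab, Or.inl h⟩)

/-- Every edge of `B` is spanned by edges of `T` of no larger weight. -/
lemma reach_light {α : Type*} (P Q : Set α) (hP : P.Finite) (hQ : Q.Finite)
    (t : α → ℝ) (H : SimpleGraph α) (W : ℝ)
    (hH : ∀ a b, (a, b) ∈ TSet P Q t → t b - t a ≤ W → H.Reachable a b)
    {p q : α} (hB : Bedge P Q t p q) (hw : t q - t p ≤ W) : H.Reachable p q := by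
  by_contra hn
  let S : Set (α × α) := {e | Bedge P Q t e.1 e.2 ∧ t e.2 - t e.1 ≤ W ∧ ¬ H.Reachable e.1 e.2}
  have hSf : S.Finite := (hP.prod hQ).subset (fun e he => ⟨he.1.1, he.1.2.1⟩)
  obtain ⟨⟨a, b⟩, ⟨hab, hW, hr⟩, hmin⟩ :=
    Set.exists_min_image S (fun e => t e.2 - t e.1) hSf ⟨(p, q), hB, hw, hn⟩
  dsimp only at hab hW hr hmin
  have key : ∀ c d, Bedge P Q t c d → t d - t c < t b - t a → H.Reachable c d := by
    intro c d hcd hlt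
    by_contra hc
    have := hmin (c, d) ⟨hcd, by dsimp only; linarith, hc⟩
    dsimp only at this
    linarith
  by_cases hT : (a, b) ∈ TSet P Q t
  · exact hr (hH a b hT hW)
  · have : ∃ p' ∈ P, ∃ q' ∈ Q, t a < t p' ∧ t p' ≤ t q' ∧ t q' < t b := by
      by_contra h
      exact hT ⟨hab.1, hab.2.1, hab.2.2, h⟩
    obtain ⟨p', hp', q', hq', h1, h2, h3⟩ := this
    have r1 := key a q' ⟨hab.1, hq', by linarith⟩ (by linarith)
    have r2 := key p' q' ⟨hp', hq', by linarith⟩ (by linarith)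
    have r3 := key p' b ⟨hp', hab.2.1, by linarith⟩ (by linarith)
    exact hr ((r1.trans r2.symm).trans r3)

lemma T_acyclic {α : Type*} (P Q : Set α) (hdisj : Disjoint P Q)
    (t : α → ℝ) (ht : Set.InjOn t (P ∪ Q)) : (GG (TSet P Q t)).IsAcyclic := by
  intro v c hc
  have hPQ : ∀ x, x ∈ P → x ∈ Q → False := fun x h1 h2 => Set.disjoint_left.1 hdisj h1 h2
  have adjT : ∀ a b, c.toSubgraph.Adj a b → (a, b) ∈ TSet P Q t ∨ (b, a) ∈ TSet P Q t :=
    fun a b h => ((SimpleGraph.fromRel_adj _ _ _).1 h.adj_sub).2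
  have two : ∀ x ∈ c.support, ∃ a b, a ≠ b ∧ c.toSubgraph.Adj x a ∧ c.toSubgraph.Adj x b := by
    intro x hx
    obtain ⟨a, b, hab, hs⟩ := Set.ncard_eq_two.1 (hc.ncard_neighborSet_toSubgraph_eq_two hx)
    refine ⟨a, b, hab, ?_, ?_⟩
    · rw [← SimpleGraph.Subgraph.mem_neighborSet, hs]; simp
    · rw [← SimpleGraph.Subgraph.mem_neighborSet, hs]; simp
  have supp : ∀ a b, c.toSubgraph.Adj a b → b ∈ c.support := by
    intro a b h
    exact (SimpleGraph.Walk.mem_verts_toSubgraph _).1 h.snd_mem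
  let S : Set α := {x | x ∈ c.support ∧ x ∈ P}
  have hSf : S.Finite := (List.finite_toSet c.support).subset (fun x hx => hx.1)
  have hSn : S.Nonempty := by
    obtain ⟨a, b, -, h1, -⟩ := two v c.start_mem_support
    rcases adjT _ _ h1 with h | h
    · exact ⟨v, c.start_mem_support, h.1⟩
    · exact ⟨a, supp _ _ h1, h.1⟩
  obtain ⟨p, ⟨hps, hpP⟩, hmax⟩ := Set.exists_max_image S t hSf hSn
  have fwd : ∀ a b, a ∈ P → c.toSubgraph.Adj a b → (a, b) ∈ TSet P Q t := by
    intro a b ha h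
    rcases adjT _ _ h with h | h
    · exact h
    · exact (hPQ a ha h.2.1).elim
  have main : ∀ q1 q2, c.toSubgraph.Adj p q1 → c.toSubgraph.Adj p q2 → t q1 < t q2 → False := by
    intro q1 q2 h1 h2 hlt
    have T1 := fwd _ _ hpP h1
    have T2 := fwd _ _ hpP h2
    obtain ⟨a, b, hab, ha, hb⟩ := two q2 (supp _ _ h2)
    have : ∃ p', p' ≠ p ∧ c.toSubgraph.Adj q2 p' := by
      by_cases h : a = p
      · exact ⟨b, fun h' => hab (h.trans h'.symm), hb⟩
      · exact ⟨a, h, ha⟩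
    obtain ⟨p', hne, hadj⟩ := this
    have T3 : (p', q2) ∈ TSet P Q t := by
      rcases adjT _ _ hadj with h | h
      · exact (hPQ q2 h.1 T2.2.1).elim
      · exact h
    have hle := hmax p' ⟨supp _ _ hadj, T3.1⟩
    have hlt' : t p' < t p :=
      lt_of_le_of_ne hle (fun h => hne (ht (Or.inl T3.1) (Or.inl hpP) h))
    exact T3.2.2.2 ⟨p, hpP, q1, T1.2.1, hlt', T1.2.2.1, hlt⟩
  obtain ⟨q1, q2, hne, h1, h2⟩ := two p hps
  rcases lt_trichotomy (t q1) (t q2) with h | h | h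
  · exact main _ _ h1 h2 h
  · exact hne (ht (Or.inr (fwd _ _ hpP h1).2.1) (Or.inr (fwd _ _ hpP h2).2.1) h)
  · exact main _ _ h2 h1 h

/-- The exchange step. -/
lemma exchange {α : Type*} (P Q : Set α) (hdisj : Disjoint P Q) (hP : P.Finite) (hQ : Q.Finite)
    (t : α → ℝ) (ht : Set.InjOn t (P ∪ Q)) (T' : Set (α × α))
    (hT' : ∀ pq ∈ T', Bedge P Q t pq.1 pq.2)
    (hsp : ∀ x y, Bedge P Q t x y → (GG T').Reachable x y)
    (e : α × α) (he : e ∈ TSet P Q t) (heT' : e ∉ T') :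
    ∃ f ∈ T', f ∉ TSet P Q t ∧ t e.2 - t e.1 ≤ t f.2 - t f.1 ∧
      ∀ x y, Bedge P Q t x y → (GG (insert e (T' \ {f}))).Reachable x y := by
  obtain ⟨x, y⟩ := e
  have hPQ : ∀ x, x ∈ P → x ∈ Q → False := fun x h1 h2 => Set.disjoint_left.1 hdisj h1 h2
  have hxy : x ≠ y := fun h => hPQ x he.1 (h ▸ he.2.1)
  have hadj : (GG (TSet P Q t)).Adj x y := (SimpleGraph.fromRel_adj _ _ _).2 ⟨hxy, Or.inl he⟩
  have hbr := SimpleGraph.isBridge_iff.1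
    (SimpleGraph.isAcyclic_iff_forall_adj_isBridge.1 (T_acyclic P Q hdisj t ht) hadj)
  set K := (GG (TSet P Q t)).deleteEdges {s(x, y)} with hK
  have hKr : ∀ a b, (a, b) ∈ TSet P Q t → (a, b) ≠ (x, y) → K.Reachable a b := by
    intro a b hab hne
    refine SimpleGraph.Adj.reachable ?_
    rw [hK, SimpleGraph.deleteEdges_adj, SimpleGraph.fromRel_adj]
    refine ⟨⟨fun h => hPQ a hab.1 (h ▸ hab.2.1), Or.inl hab⟩, ?_⟩
    intro h
    rcases Sym2.eq_iff.1 h with ⟨h1, h2⟩ | ⟨h1, h2⟩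
    · exact hne (by rw [h1, h2])
    · exact hPQ a hab.1 (h1 ▸ he.2.1)
  obtain ⟨w, hw⟩ := (hsp x y ⟨he.1, he.2.1, he.2.2.1⟩).symm.exists_isPath
  obtain ⟨d, hd, hd1, hd2⟩ := w.exists_boundary_dart {v | K.Reachable y v}
    (SimpleGraph.Reachable.refl _) (fun h => hbr h.symm)
  have hnr : ¬ K.Reachable d.fst d.snd := fun h => hd2 (SimpleGraph.Reachable.trans hd1 h)
  have hde : d.edge ∈ w.edges := List.mem_map_of_mem hd
  have : ∃ a b, (a, b) ∈ T' ∧ s(a, b) ∈ w.edges ∧ ¬ K.Reachable a b := by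
    rcases ((SimpleGraph.fromRel_adj _ _ _).1 d.adj).2 with h | h
    · exact ⟨_, _, h, hde, hnr⟩
    · exact ⟨_, _, h, by rw [Sym2.eq_swap]; exact hde, fun h => hnr h.symm⟩
  obtain ⟨a, b, hab, habw, habr⟩ := this
  have hne : (a, b) ≠ (x, y) := fun h => heT' (h ▸ hab)
  refine ⟨(a, b), hab, fun h => habr (hKr a b h hne), ?_, ?_⟩
  · by_contra hlt
    push Not at hlt
    refine habr (reach_light P Q hP hQ t K (t b - t a) ?_ (hT' _ hab) le_rfl)
    intro c d hcd hle
    refine hKr c d hcd (fun h => ?_)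
    obtain ⟨rfl, rfl⟩ := Prod.mk.inj h
    exact absurd hle (not_le.2 hlt)
  · -- the cycle through `e` and `f`
    have hle : GG T' ≤ GG (insert (x, y) T') := by
      intro u v huv
      rw [SimpleGraph.fromRel_adj] at huv ⊢
      exact ⟨huv.1, huv.2.imp (Or.inr ·) (Or.inr ·)⟩
    have hadj' : (GG (insert (x, y) T')).Adj x y :=
      (SimpleGraph.fromRel_adj _ _ _).2 ⟨hxy, Or.inl (Or.inl rfl)⟩
    have hcyc : (SimpleGraph.Walk.cons hadj' (w.mapLe hle)).IsCycle := by
      rw [SimpleGraph.Walk.cons_isCycle_iff]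
      refine ⟨hw.mapLe hle, ?_⟩
      rw [SimpleGraph.Walk.edges_mapLe_eq_edges]
      intro h
      have h' := (SimpleGraph.fromRel_adj _ _ _).1 (w.adj_of_mem_edges h)
      rcases h'.2 with h | h
      · exact heT' h
      · exact hPQ x he.1 (hT' _ h).2.1
    have hmem : s(a, b) ∈ (SimpleGraph.Walk.cons hadj' (w.mapLe hle)).edges := by
      rw [SimpleGraph.Walk.edges_cons, SimpleGraph.Walk.edges_mapLe_eq_edges]
      exact List.mem_cons_of_mem _ habw
    have hnb : ¬ (GG (insert (x, y) T')).IsBridge s(a, b) := by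
      rw [SimpleGraph.isBridge_iff_forall_cycle_notMem
        (SimpleGraph.Walk.edges_subset_edgeSet _ hmem)]
      exact fun h => h _ hcyc hmem
    rw [SimpleGraph.isBridge_iff, not_not] at hnb
    have hr : (GG (insert (x, y) (T' \ {(a, b)}))).Reachable a b := by
      refine hnb.mono ?_
      intro u v huv
      rw [SimpleGraph.deleteEdges_adj, SimpleGraph.fromRel_adj] at huv
      rw [SimpleGraph.fromRel_adj]
      refine ⟨huv.1.1, ?_⟩
      have h1 : (u, v) ≠ (a, b) := fun h => huv.2 (by
        obtain ⟨rfl, rfl⟩ := Prod.mk.inj h; rfl)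
      have h2 : (v, u) ≠ (a, b) := fun h => huv.2 (by
        obtain ⟨rfl, rfl⟩ := Prod.mk.inj h; exact Sym2.eq_swap)
      rcases huv.1.2 with (h | h) | (h | h)
      · exact Or.inl (Or.inl h)
      · exact Or.inl (Or.inr ⟨h, h1⟩)
      · exact Or.inr (Or.inl h)
      · exact Or.inr (Or.inr ⟨h, h2⟩)
    intro u v huv
    refine GG_reach_of (fun c d hcd => ?_) (hsp u v huv)
    by_cases h : (c, d) = (a, b)
    · obtain ⟨rfl, rfl⟩ := Prod.mk.inj h
      exact hr
    · exact GG_reach_mem (Or.inr ⟨hcd, h⟩)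

lemma min_weight {α : Type*} (P Q : Set α) (hdisj : Disjoint P Q) (hP : P.Finite) (hQ : Q.Finite)
    (t : α → ℝ) (ht : Set.InjOn t (P ∪ Q)) (n : ℕ) : ∀ T' : Set (α × α),
    (TSet P Q t \ T').ncard = n →
    (∀ pq ∈ T', Bedge P Q t pq.1 pq.2) →
    (∀ x y, Bedge P Q t x y → (GG T').Reachable x y) →
    ∑ᶠ pq ∈ TSet P Q t, (t pq.2 - t pq.1) ≤ ∑ᶠ pq ∈ T', (t pq.2 - t pq.1) := by
  have hTf : (TSet P Q t).Finite := (hP.prod hQ).subset (fun e he => ⟨he.1, he.2.1⟩)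
  induction n using Nat.strong_induction_on with
  | _ n ih =>
  intro T' hn hT' hsp
  have hf : T'.Finite := (hP.prod hQ).subset (fun e he => ⟨(hT' e he).1, (hT' e he).2.1⟩)
  by_cases hsub : TSet P Q t ⊆ T'
  · rw [← Set.union_sdiff_cancel hsub,
      finsum_mem_union Set.disjoint_sdiff_right hTf (hf.subset Set.sdiff_subset)]
    have : 0 ≤ ∑ᶠ pq ∈ T' \ TSet P Q t, (t pq.2 - t pq.1) :=
      finsum_nonneg fun i => finsum_nonneg fun hi => by
        have := (hT' i hi.1).2.2
        linarith
    linarith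
  · obtain ⟨e, he, heT'⟩ := Set.not_subset.1 hsub
    obtain ⟨f, hfT', hfT, hwt, hsp'⟩ := exchange P Q hdisj hP hQ t ht T' hT' hsp e he heT'
    have hff : (T' \ {f}).Finite := hf.subset Set.sdiff_subset
    have h1 := ih ((TSet P Q t \ insert e (T' \ {f})).ncard) (by
      rw [← hn]
      refine Set.ncard_lt_ncard ?_ (hTf.subset Set.sdiff_subset)
      refine ⟨fun g hg => ⟨hg.1, fun h => hg.2 (Or.inr ⟨h, ?_⟩)⟩, fun h => ?_⟩
      · rintro rfl
        exact hfT hg.1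
      · exact (h ⟨he, heT'⟩).2 (Or.inl rfl)) (insert e (T' \ {f})) rfl (by
      rintro pq (rfl | h)
      · exact ⟨he.1, he.2.1, he.2.2.1⟩
      · exact hT' _ h.1) hsp'
    rw [finsum_mem_insert _ (fun h => heT' h.1) hff] at h1
    have h2 : T' = insert f (T' \ {f}) := by
      ext g
      by_cases hg : g = f
      · subst hg; simp [hfT']
      · simp [hg]
    rw [h2, finsum_mem_insert _ (fun h => h.2 rfl) hff]
    linarith

/-- **The node-local skeleton is a minimum-weight spanning forest.**
Let `P`, `Q` be disjoint finite sets with injective time function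
`t : P ⊔ Q → ℝ` and let `B` be the associated weighted bipartite graph.
The edge set `T = TSet P Q t` satisfies:
(a) the graph on `P ⊔ Q` with edge set `T` has the same connected components
    as `B`;
(b) the graph with edge set `T` is acyclic; and
(c) the total weight of `T` is at most that of any edge set `T'` of `B` whose
    graph has the same connected components as `B`. -/
theorem skeleton_is_min_spanning_forest {α : Type*}
    (P Q : Set α) (hdisj : Disjoint P Q) (hP : P.Finite) (hQ : Q.Finite)
    (t : α → ℝ) (ht : Set.InjOn t (P ∪ Q)) :
    (∀ x y : α,
        (SimpleGraph.fromRel fun a b => (a, b) ∈ TSet P Q t).Reachable x y ↔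
        (SimpleGraph.fromRel (Bedge P Q t)).Reachable x y) ∧
    (SimpleGraph.fromRel fun a b => (a, b) ∈ TSet P Q t).IsAcyclic ∧
    (∀ T' : Set (α × α), (∀ pq ∈ T', Bedge P Q t pq.1 pq.2) →
      (∀ x y : α,
          (SimpleGraph.fromRel fun a b => (a, b) ∈ T').Reachable x y ↔
          (SimpleGraph.fromRel (Bedge P Q t)).Reachable x y) →
      ∑ᶠ pq ∈ TSet P Q t, (t pq.2 - t pq.1) ≤ ∑ᶠ pq ∈ T', (t pq.2 - t pq.1)) := by
  have hB : ∀ x y, Bedge P Q t x y → (SimpleGraph.fromRel (Bedge P Q t)).Reachable x y := by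
    intro x y h
    exact SimpleGraph.Adj.reachable ((SimpleGraph.fromRel_adj _ _ _).2
      ⟨fun h' => Set.disjoint_left.1 hdisj h.1 (h' ▸ h.2.1), Or.inl h⟩)
  refine ⟨fun x y => ⟨?_, ?_⟩, T_acyclic P Q hdisj t ht, ?_⟩
  · exact GG_reach_of fun a b hab => hB a b ⟨hab.1, hab.2.1, hab.2.2.1⟩
  · refine reach_of_adj_reach fun a b hab => ?_
    rcases ((SimpleGraph.fromRel_adj _ _ _).1 hab).2 with h | h
    · exact reach_light P Q hP hQ t _ _ (fun c d hcd _ => GG_reach_mem hcd) h le_rfl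
    · exact (reach_light P Q hP hQ t _ _ (fun c d hcd _ => GG_reach_mem hcd) h le_rfl).symm
  · intro T' hT' hsp
    exact min_weight P Q hdisj hP hQ t ht _ T' rfl hT' fun x y h => (hsp x y).2 (hB x y h)
end

section
/- Let G be a dynamic multigraph with edge set E whose timestamps are pairwise distinct, let L_G be its increment-weighted line graph, and let L*_G = ⋃_v T_v be its line graph skeleton. Then L_G and L*_G have equivalent weighted connectivity: for every threshold ω ∈ ℝ and all e, e' ∈ E, there is an ω-path from e to e' in L_G if and only if there is an ω-path from e to e' in L*_G. -/
/-- An edge of a dynamic multigraph: a source, a target and a timestamp. -/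
abbrev DynEdge (V : Type*) := V × V × ℝ

/-- Source vertex of a dynamic edge. -/
def src {V : Type*} (e : DynEdge V) : V := e.1

/-- Target vertex of a dynamic edge. -/
def tgt {V : Type*} (e : DynEdge V) : V := e.2.1

/-- Timestamp of a dynamic edge. -/
def tm {V : Type*} (e : DynEdge V) : ℝ := e.2.2

/-- The directed adjacency of the increment-weighted line graph `L_G`:
an edge from `e` to `e'` iff `e, e' ∈ E`, they are tip-to-tail
(`tgt e = src e'`) and causal (`tm e ≤ tm e'`); its weight is `tm e' - tm e`. -/
def LineAdj {V : Type*} (E : Set (DynEdge V)) (e e' : DynEdge V) : Prop :=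
  e ∈ E ∧ e' ∈ E ∧ tgt e = src e' ∧ tm e ≤ tm e'

/-- One undirected step of an `ω`-path in `L_G`: traverse a line-graph edge in
either direction, provided its weight is at most `ω`. -/
def LineStep {V : Type*} (E : Set (DynEdge V)) (ω : ℝ) (x y : DynEdge V) : Prop :=
  (LineAdj E x y ∧ tm y - tm x ≤ ω) ∨ (LineAdj E y x ∧ tm x - tm y ≤ ω)

/-- The node-local skeleton `T_v` at vertex `v`: line-graph edges `(e_p, e_q)`
where `e_p` is an in-edge at `v`, `e_q` is an out-edge at `v`, `t_p ≤ t_q`, and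
there are no in-edge `e_{p'}` and out-edge `e_{q'}` at `v` with
`t_p < t_{p'} ≤ t_{q'} < t_q`. -/
def Skel {V : Type*} (E : Set (DynEdge V)) (v : V) : Set (DynEdge V × DynEdge V) :=
  { pq | pq.1 ∈ E ∧ pq.2 ∈ E ∧ tgt pq.1 = v ∧ src pq.2 = v ∧ tm pq.1 ≤ tm pq.2 ∧
      ¬ ∃ p' ∈ E, ∃ q' ∈ E, tgt p' = v ∧ src q' = v ∧
          tm pq.1 < tm p' ∧ tm p' ≤ tm q' ∧ tm q' < tm pq.2 }

/-- One undirected step of an `ω`-path in the line graph skeleton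
`L*_G = ⋃_v T_v`. -/
def SkelStep {V : Type*} (E : Set (DynEdge V)) (ω : ℝ) (x y : DynEdge V) : Prop :=
  ((∃ v, (x, y) ∈ Skel E v) ∧ tm y - tm x ≤ ω) ∨
  ((∃ v, (y, x) ∈ Skel E v) ∧ tm x - tm y ≤ ω)

theorem skel_path_of_adj {V : Type*} (E : Set (DynEdge V)) (hfin : E.Finite) (ω : ℝ) (n : ℕ) :
    ∀ p q : DynEdge V, {e ∈ E | tm p ≤ tm e ∧ tm e ≤ tm q}.ncard = n →
      LineAdj E p q → tm q - tm p ≤ ω →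
      Relation.ReflTransGen (SkelStep E ω) p q := by
  induction n using Nat.strong_induction_on with
  | _ n ih =>
    intro p q hn hadj hw
    obtain ⟨hp, hq, hpq, ht⟩ := hadj
    by_cases h : ∃ p' ∈ E, ∃ q' ∈ E, tgt p' = tgt p ∧ src q' = tgt p ∧
          tm p < tm p' ∧ tm p' ≤ tm q' ∧ tm q' < tm q
    · obtain ⟨p', hp', q', hq', h1, h2, h3, h4, h5⟩ := h
      have key : ∀ a b : DynEdge V, LineAdj E a b → tm p ≤ tm a → tm b ≤ tm q →
          (tm p < tm a ∨ tm b < tm q) → Relation.ReflTransGen (SkelStep E ω) a b := by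
        intro a b hab ha hb hs
        refine ih _ ?_ a b rfl hab (by linarith)
        rw [← hn]
        refine Set.ncard_lt_ncard ?_ (hfin.subset (fun e he => he.1))
        have hsub : {e ∈ E | tm a ≤ tm e ∧ tm e ≤ tm b} ⊆ {e ∈ E | tm p ≤ tm e ∧ tm e ≤ tm q} :=
          fun e he => ⟨he.1, ha.trans he.2.1, he.2.2.trans hb⟩
        rw [Set.ssubset_iff_of_subset hsub]
        rcases hs with hs | hs
        · exact ⟨p, ⟨hp, le_rfl, ht⟩, fun hx => absurd hx.2.1 (not_le.mpr hs)⟩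
        · exact ⟨q, ⟨hq, ht, le_rfl⟩, fun hx => absurd hx.2.2 (not_le.mpr hs)⟩
      have k1 := key p q' ⟨hp, hq', h2.symm, by linarith⟩ le_rfl h5.le (Or.inr h5)
      have k2 := key p' q' ⟨hp', hq', h1.trans h2.symm, h4⟩ h3.le h5.le (Or.inr h5)
      have k3 := key p' q ⟨hp', hq, h1.trans hpq, by linarith⟩ h3.le le_rfl (Or.inl h3)
      have hsymm : Std.Symm (SkelStep E ω) := ⟨fun _ _ h => Or.symm h⟩
      exact (k1.trans (Relation.ReflTransGen.stdSymm.symm _ _ k2)).trans k3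
    · exact Relation.ReflTransGen.single
        (Or.inl ⟨⟨tgt p, hp, hq, rfl, hpq.symm, ht, h⟩, hw⟩)

/-- **Equivalent weighted connectivity of the line graph skeleton.**
For a dynamic multigraph with finitely many edges, no self-loops and pairwise
distinct timestamps, the increment-weighted line graph `L_G` and its skeleton
`L*_G` have the same `ω`-filtered connectivity for every threshold `ω`. -/
theorem skeleton_equiv_connectivity {V : Type*} [Finite V]
    (E : Set (DynEdge V)) (hfin : E.Finite)
    (hloop : ∀ e ∈ E, src e ≠ tgt e)
    (htimes : Set.InjOn tm E) :
    ∀ (ω : ℝ), ∀ e ∈ E, ∀ e' ∈ E,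
      (Relation.ReflTransGen (LineStep E ω) e e' ↔
       Relation.ReflTransGen (SkelStep E ω) e e') := by
  intro ω e he e' he'
  have hsymm : Std.Symm (SkelStep E ω) := ⟨fun _ _ h => Or.symm h⟩
  constructor
  · intro h
    induction h with
    | refl => exact .refl
    | tail _ hs ih =>
      rcases hs with ⟨ha, hw⟩ | ⟨ha, hw⟩
      · exact (ih ha.1).trans (skel_path_of_adj E hfin ω _ _ _ rfl ha hw)
      · exact (ih ha.2.1).trans (Relation.ReflTransGen.stdSymm.symm _ _
          (skel_path_of_adj E hfin ω _ _ _ rfl ha hw))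
  · refine Relation.ReflTransGen.mono (?_ : SkelStep E ω ≤ LineStep E ω) e e'
    rintro a b (⟨⟨v, h1, h2, h3, h4, h5, -⟩, hw⟩ | ⟨⟨v, h1, h2, h3, h4, h5, -⟩, hw⟩)
    · exact Or.inl ⟨⟨h1, h2, h3.trans h4.symm, h5⟩, hw⟩
    · exact Or.inr ⟨⟨h1, h2, h3.trans h4.symm, h5⟩, hw⟩
end

section
/- Let G be a dynamic multigraph with edge set E whose timestamps are pairwise distinct, let v be a vertex, and let T_v be the node-local skeleton at v. Then for every threshold ω ∈ ℝ and every in-edge e_p at v and out-edge e_q at v with t_p ≤ t_q and t_q − t_p ≤ ω, there is an undirected path from e_p to e_q using only edges of T_v, all of whose weights are at most ω. -/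
/-- One undirected step along the node-local skeleton `T_v`, using only edges
of weight at most `ω`. -/
def SkelLocalStep {V : Type*} (E : Set (DynEdge V)) (v : V) (ω : ℝ)
    (x y : DynEdge V) : Prop :=
  ((x, y) ∈ Skel E v ∧ tm y - tm x ≤ ω) ∨ ((y, x) ∈ Skel E v ∧ tm x - tm y ≤ ω)

/-- **Local weighted connectivity of the node-local skeleton.**
For a dynamic multigraph with finitely many edges, no self-loops and pairwise
distinct timestamps, for every threshold `ω`, every in-edge `e_p` and out-edge
`e_q` at a vertex `v` with `t_p ≤ t_q` and `t_q - t_p ≤ ω` are joined by an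
undirected path using only edges of `T_v` of weight at most `ω`. -/
theorem skeleton_local_connectivity {V : Type*} [Finite V]
    (E : Set (DynEdge V)) (hfin : E.Finite)
    (hloop : ∀ e ∈ E, src e ≠ tgt e)
    (htimes : Set.InjOn tm E) (v : V) :
    ∀ (ω : ℝ) (ep eq : DynEdge V),
      ep ∈ E → tgt ep = v → eq ∈ E → src eq = v →
      tm ep ≤ tm eq → tm eq - tm ep ≤ ω →
      Relation.ReflTransGen (SkelLocalStep E v ω) ep eq := by
  intro ω
  have hsymm : ∀ x y, SkelLocalStep E v ω x y → SkelLocalStep E v ω y x :=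
    fun x y h => Or.symm h
  have hlt : ∀ a b c d : ℝ, a ≤ c → d ≤ b → (∃ e ∈ E, (a ≤ tm e ∧ tm e ≤ b) ∧
      ¬ (c ≤ tm e ∧ tm e ≤ d)) →
      {e ∈ E | c ≤ tm e ∧ tm e ≤ d}.ncard < {e ∈ E | a ≤ tm e ∧ tm e ≤ b}.ncard := by
    rintro a b c d hac hdb ⟨e, heE, he, hne⟩
    apply Set.ncard_lt_ncard _ (hfin.subset (Set.sep_subset _ _))
    refine ⟨fun x hx => ⟨hx.1, hac.trans hx.2.1, hx.2.2.trans hdb⟩, fun h => ?_⟩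
    exact hne (h (show e ∈ {e ∈ E | a ≤ tm e ∧ tm e ≤ b} from ⟨heE, he⟩)).2
  have key : ∀ (n : ℕ) (p q : DynEdge V), {e ∈ E | tm p ≤ tm e ∧ tm e ≤ tm q}.ncard = n →
      p ∈ E → tgt p = v → q ∈ E → src q = v → tm p ≤ tm q → tm q - tm p ≤ ω →
      Relation.ReflTransGen (SkelLocalStep E v ω) p q := by
    intro n
    induction n using Nat.strong_induction_on with
    | _ n ih =>
      intro p q hn hp hpv hq hqv hpq hw
      by_cases hS : (p, q) ∈ Skel E v
      · exact Relation.ReflTransGen.single (Or.inl ⟨hS, hw⟩)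
      · have hex : ∃ p' ∈ E, ∃ q' ∈ E, tgt p' = v ∧ src q' = v ∧
            tm p < tm p' ∧ tm p' ≤ tm q' ∧ tm q' < tm q := by
          by_contra hne
          exact hS ⟨hp, hq, hpv, hqv, hpq, hne⟩
        obtain ⟨p', hp', q', hq', hpv', hqv', h1, h2, h3⟩ := hex
        subst hn
        have r1 := ih _ (hlt (tm p) (tm q) (tm p) (tm q') le_rfl h3.le
          ⟨q, hq, ⟨hpq, le_rfl⟩, fun h => absurd h.2 (not_le.2 h3)⟩) p q' rfl
          hp hpv hq' hqv' (by linarith) (by linarith)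
        have r2 := ih _ (hlt (tm p) (tm q) (tm p') (tm q') h1.le h3.le
          ⟨q, hq, ⟨hpq, le_rfl⟩, fun h => absurd h.2 (not_le.2 h3)⟩) p' q' rfl
          hp' hpv' hq' hqv' h2 (by linarith)
        have r3 := ih _ (hlt (tm p) (tm q) (tm p') (tm q) h1.le le_rfl
          ⟨p, hp, ⟨le_rfl, hpq⟩, fun h => absurd h.1 (not_le.2 h1)⟩) p' q rfl
          hp' hpv' hq hqv (by linarith) (by linarith)
        have r2' : Relation.ReflTransGen (SkelLocalStep E v ω) q' p' := by
          have := r2.swap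
          exact Relation.ReflTransGen.mono (fun x y h => hsymm y x h) _ _ this
        exact (r1.trans r2').trans r3
  intro p q hp hpv hq hqv hpq hw
  exact key _ p q rfl hp hpv hq hqv hpq hw
end

section
/- Let G be a dynamic multigraph with edge set E whose timestamps are pairwise distinct, and for each vertex v let T_v be the node-local skeleton at v and d_v the number of edges incident to v. Let V' be the set of vertices incident to at least one edge of E. Then the total number of skeleton edges satisfies Σ_v |T_v| ≤ Σ_{v ∈ V'} (d_v − 1) = 2·|E| − |V'|. -/
theorem skel_card_aux {V : Type*} [DecidableEq V]
    (E : Finset (DynEdge V))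
    (hloop : ∀ e ∈ E, src e ≠ tgt e)
    (htimes : Set.InjOn tm (E : Set (DynEdge V))) (v : V)
    (hne : (Skel (E : Set (DynEdge V)) v).Nonempty) :
    (Skel (E : Set (DynEdge V)) v).ncard + 1 ≤
      (E.filter fun e => src e = v ∨ tgt e = v).card := by
  classical
  obtain ⟨⟨p1, q1⟩, hp1, hq1, hpv1, hqv1, hle1, -⟩ := hne
  obtain ⟨q0, hq0, hmin⟩ := Finset.exists_min_image
    (E.filter fun q => src q = v ∧ ∃ p ∈ E, tgt p = v ∧ tm p ≤ tm q) tm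
    ⟨q1, Finset.mem_filter.2 ⟨hq1, hqv1, p1, hp1, hpv1, hle1⟩⟩
  rw [Finset.mem_filter] at hq0
  obtain ⟨hq0E, hq0v, -⟩ := hq0
  have hq0mem : q0 ∈ E.filter fun e => src e = v ∨ tgt e = v :=
    Finset.mem_filter.2 ⟨hq0E, Or.inl hq0v⟩
  let f : DynEdge V × DynEdge V → DynEdge V := fun pq =>
    if ∃ o ∈ E, src o = v ∧ tm pq.1 ≤ tm o ∧ tm o < tm pq.2 then pq.2 else pq.1
  have key : (Skel (E : Set (DynEdge V)) v).ncard ≤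
      ((((E.filter fun e => src e = v ∨ tgt e = v).erase q0 : Finset (DynEdge V))) :
        Set (DynEdge V)).ncard := by
    refine Set.ncard_le_ncard_of_injOn f ?_ ?_ (Finset.finite_toSet _)
    · rintro ⟨p, q⟩ ⟨hp, hq, hpv, hqv, hle, -⟩
      simp only [Finset.mem_coe] at hp hq
      simp only at hpv hqv hle
      simp only [f, Finset.mem_coe, Finset.mem_erase, Finset.mem_filter]
      split_ifs with h
      · obtain ⟨o, ho, hov, h1, h2⟩ := h
        refine ⟨?_, hq, Or.inl hqv⟩
        rintro rfl
        exact absurd (hmin o (Finset.mem_filter.2 ⟨ho, hov, p, hp, hpv, h1⟩)) (not_le.2 h2)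
      · refine ⟨?_, hp, Or.inr hpv⟩
        rintro rfl
        exact hloop _ hp (hq0v.trans hpv.symm)
    · rintro ⟨p, q⟩ ⟨hp, hq, hpv, hqv, hle, hn⟩ ⟨p', q'⟩ ⟨hp', hq', hpv', hqv', hle', hn'⟩ hf
      simp only [Finset.mem_coe] at hp hq hp' hq' hn hn'
      simp only at hpv hqv hle hpv' hqv' hle'
      simp only [f] at hf
      split_ifs at hf with h h' h'
      · subst hf
        obtain ⟨o, ho, hov, h1, h2⟩ := h
        obtain ⟨o', ho', hov', h1', h2'⟩ := h'
        have : p = p' := by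
          apply htimes hp hp'
          rcases lt_trichotomy (tm p) (tm p') with hl | he | hl
          · exact absurd ⟨p', hp', o', ho', hpv', hov', hl, h1', h2'⟩ hn
          · exact he
          · exact absurd ⟨p, hp, o, ho, hpv, hov, hl, h1, h2⟩ hn'
        rw [this]
      · subst hf
        exact absurd (hqv.trans hpv'.symm) (hloop _ hq)
      · subst hf
        exact absurd (hqv'.trans hpv.symm) (hloop _ hp)
      · subst hf
        have : q = q' := by
          apply htimes hq hq'
          rcases lt_trichotomy (tm q) (tm q') with hl | he | hl
          · exact absurd ⟨q, hq, hqv, hle, hl⟩ h'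
          · exact he
          · exact absurd ⟨q', hq', hqv', hle', hl⟩ h
        rw [this]
  rw [Set.ncard_coe_finset] at key
  have := Finset.card_erase_add_one hq0mem
  omega

/-- **Size bound for the line graph skeleton.**  For a dynamic multigraph with
finite vertex type, edge set `E` (a finite set of loop-free edges) and pairwise
distinct timestamps, letting `d_v` be the number of edges incident to `v` and
`V'` the set of vertices incident to at least one edge, the total number of
skeleton edges satisfies
`Σ_v |T_v| ≤ Σ_{v ∈ V'} (d_v - 1) = 2|E| - |V'|`. -/
theorem skeleton_size_bound {V : Type*} [Fintype V] [DecidableEq V]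
    (E : Finset (DynEdge V))
    (hloop : ∀ e ∈ E, src e ≠ tgt e)
    (htimes : Set.InjOn tm (E : Set (DynEdge V))) :
    (∑ v : V, ((Skel (E : Set (DynEdge V)) v).ncard : ℤ)) ≤
        ∑ v ∈ Finset.univ.filter (fun v : V => ∃ e ∈ E, src e = v ∨ tgt e = v),
          (((E.filter fun e => src e = v ∨ tgt e = v).card : ℤ) - 1) ∧
      ∑ v ∈ Finset.univ.filter (fun v : V => ∃ e ∈ E, src e = v ∨ tgt e = v),
          (((E.filter fun e => src e = v ∨ tgt e = v).card : ℤ) - 1) =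
        2 * (E.card : ℤ) -
          (Finset.univ.filter (fun v : V => ∃ e ∈ E, src e = v ∨ tgt e = v)).card := by
  classical
  constructor
  · rw [Finset.sum_filter]
    refine Finset.sum_le_sum fun v _ => ?_
    rcases Set.eq_empty_or_nonempty (Skel (E : Set (DynEdge V)) v) with h | h
    · rw [h]
      split_ifs with hv
      · obtain ⟨e, he, hev⟩ := hv
        have : 0 < (E.filter fun e => src e = v ∨ tgt e = v).card :=
          Finset.card_pos.2 ⟨e, Finset.mem_filter.2 ⟨he, hev⟩⟩
        simp only [Set.ncard_empty]
        omega
      · simp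
    · have h2 := skel_card_aux E hloop htimes v h
      obtain ⟨pq, hp, -, hpv, -⟩ := h
      rw [if_pos ⟨pq.1, hp, Or.inr hpv⟩]
      omega
  · rw [Finset.sum_sub_distrib]
    have h1 : ∑ v ∈ Finset.univ.filter (fun v : V => ∃ e ∈ E, src e = v ∨ tgt e = v),
          ((E.filter fun e => src e = v ∨ tgt e = v).card : ℤ) =
        ∑ v : V, ((E.filter fun e => src e = v ∨ tgt e = v).card : ℤ) := by
      apply Finset.sum_subset (Finset.filter_subset _ _)
      intro v _ hv
      simp only [Finset.mem_filter, Finset.mem_univ, true_and, not_exists, not_and] at hv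
      rw [Finset.filter_false_of_mem hv]
      simp
    have h2 : ∑ v : V, ((E.filter fun e => src e = v ∨ tgt e = v).card : ℤ) =
        2 * (E.card : ℤ) := by
      simp only [Finset.card_filter, Nat.cast_sum]
      rw [Finset.sum_comm]
      have : ∀ e ∈ E, ∑ v : V, (((if src e = v ∨ tgt e = v then 1 else 0 : ℕ)) : ℤ) = 2 := by
        intro e he
        rw [← Nat.cast_sum, ← Finset.card_filter]
        have : (Finset.univ.filter fun v : V => src e = v ∨ tgt e = v) = {src e, tgt e} := by
          ext v
          simp [eq_comm]
        rw [this, Finset.card_pair (hloop e he)]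
        rfl
      rw [Finset.sum_congr rfl this]
      simp [mul_comm]
    rw [h1, h2]
    simp
end
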